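/- Under Assumptions 1 and 3, with κ ∈ (1/(C−1), 1/2] where C = max_i max_{a_i ∈ A_i} |C_i(a_i)|, and with the exploration rate ε(k) = k^{−1/(n(D+1))} where D = max_i D_i and D_i is the minimal number of constraint-feasible steps needed to transition between any two actions of player i, the inhomogeneous Markov chain {P_k^ε} induced by PIPIP is strongly ergodic: there exists a stochastic vector μ* on B such that for every probability distribution μ on B and every k_0, lim_{k→∞} μ P(k_0, k) = μ*, where P(k_0, k) = ∏_{k'=k_0}^{k−1} P_{k'}; moreover μ* equals lim_{ε→0+} μ(ε), the limit of the unique stationary distributions μ(ε) of the homogeneous PHPIP chains {P^ε}. -/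

import Mathlib

open Filter Topology Set

attribute [local instance] Classical.propDecidable

section PHPIP

variable {ι : Type*} [Fintype ι] [DecidableEq ι] {A : ι → Type*} [∀ i, Fintype (A i)]

/-- Assumption 1 on the constraint maps. -/
def Assumption1 (C : ∀ i, A i → Finset (A i)) : Prop :=
  (∀ (i : ι) (a b : A i), b ∈ C i a ↔ a ∈ C i b) ∧
  (∀ (i : ι) (a b : A i), ∃ (nf : ℕ) (f : ℕ → A i), f 0 = a ∧ f nf = b ∧
      ∀ k < nf, f (k + 1) ∈ C i (f k)) ∧
  (∀ (i : ι) (a : A i), 3 ≤ (C i a).card)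

/-- Assumption 3: unilateral constrained deviations change the utility by less than 1/2. -/
def Assumption3 (U : ι → (∀ i, A i) → ℝ) (C : ∀ i, A i → Finset (A i)) : Prop :=
  ∀ (i : ι) (a : ∀ j, A j) (b : A i), b ∈ C i (a i) →
    U i (Function.update a i b) - U i a < 1 / 2

/-- Γ is a constrained potential game with potential function φ. -/
def IsPotentialGame (U : ι → (∀ i, A i) → ℝ) (C : ∀ i, A i → Finset (A i))
    (φ : (∀ i, A i) → ℝ) : Prop :=
  ∀ (i : ι) (a : ∀ j, A j) (b : A i), b ∈ C i (a i) →
    U i (Function.update a i b) - U i a = φ (Function.update a i b) - φ a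

/-- Probability that, from state `(a0, a1)`, player `i` selects the action `x`
under the PHPIP selection rule with exploration rate `ε` and parameter `κ`. -/
noncomputable def selProb (κ : ℝ) (U : ι → (∀ i, A i) → ℝ)
    (C : ∀ i, A i → Finset (A i)) (ε : ℝ) (a0 a1 : ∀ i, A i) (i : ι) (x : A i) : ℝ :=
  if U i a0 ≤ U i a1 then
    (if x = a1 i then 1 - ε else 0) +
      (if x ∈ (C i (a1 i)).erase (a1 i) then
        ε / ((C i (a1 i)).erase (a1 i)).card else 0)
  else
    (if x = a1 i then (1 - ε) * (κ * ε ^ (U i a0 - U i a1)) else 0) +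
      (if x = a0 i then (1 - ε) * (1 - κ * ε ^ (U i a0 - U i a1)) else 0) +
      (if x ∈ ((C i (a1 i)).erase (a1 i)).erase (a0 i) then
        ε / (((C i (a1 i)).erase (a1 i)).erase (a0 i)).card else 0)

/-- One-step transition probability of the Markov chain `{P^ε}` induced by PHPIP
on pairs of joint actions. -/
noncomputable def phTrans (κ : ℝ) (U : ι → (∀ i, A i) → ℝ)
    (C : ∀ i, A i → Finset (A i)) (ε : ℝ)
    (z1 z2 : (∀ i, A i) × (∀ i, A i)) : ℝ :=
  if z2.1 = z1.2 then ∏ i, selProb κ U C ε z1.1 z1.2 i (z2.2 i) else 0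

/-- The state space B. -/
def memB (C : ∀ i, A i → Finset (A i)) (z : (∀ i, A i) × (∀ i, A i)) : Prop :=
  ∀ i, z.2 i ∈ C i (z.1 i)

/-- k-step transition probabilities of the homogeneous chain `{P^ε}`. -/
noncomputable def phTransPow (κ : ℝ) (U : ι → (∀ i, A i) → ℝ)
    (C : ∀ i, A i → Finset (A i)) (ε : ℝ) :
    ℕ → (∀ i, A i) × (∀ i, A i) → (∀ i, A i) × (∀ i, A i) → ℝ
  | 0, z, z' => if z = z' then 1 else 0
  | k + 1, z, z' => ∑ w : (∀ i, A i) × (∀ i, A i),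
      phTrans κ U C ε z w * phTransPow κ U C ε k w z'

/-- Probability of a path (sequence of states) of the chain `{P^ε}`. -/
noncomputable def pathProb (κ : ℝ) (U : ι → (∀ i, A i) → ℝ)
    (C : ∀ i, A i → Finset (A i)) (ε : ℝ) :
    List ((∀ i, A i) × (∀ i, A i)) → ℝ
  | [] => 1
  | [_] => 1
  | z :: z' :: rest => phTrans κ U C ε z z' * pathProb κ U C ε (z' :: rest)

/-- A transition is feasible if it has positive probability for some ε ∈ (0,1/2]. -/
def Feasible (κ : ℝ) (U : ι → (∀ i, A i) → ℝ) (C : ∀ i, A i → Finset (A i))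
    (z z' : (∀ i, A i) × (∀ i, A i)) : Prop :=
  ∃ ε : ℝ, 0 < ε ∧ ε ≤ 1 / 2 ∧ 0 < phTrans κ U C ε z z'

/-- `l` is a (feasible) path of the chain from `z1` to `z2`. -/
def IsPath (κ : ℝ) (U : ι → (∀ i, A i) → ℝ) (C : ∀ i, A i → Finset (A i))
    (z1 z2 : (∀ i, A i) × (∀ i, A i)) (l : List ((∀ i, A i) × (∀ i, A i))) : Prop :=
  l.head? = some z1 ∧ l.getLast? = some z2 ∧ l.Chain' (Feasible κ U C)

/-- `r` is the resistance of the path `l`:  `lim_{ε→0+} P^ε(l)/ε^r ∈ (0,∞)`. -/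
def IsPathRes (κ : ℝ) (U : ι → (∀ i, A i) → ℝ) (C : ∀ i, A i → Finset (A i))
    (l : List ((∀ i, A i) × (∀ i, A i))) (r : ℝ) : Prop :=
  ∃ L : ℝ, 0 < L ∧
    Tendsto (fun ε : ℝ => pathProb κ U C ε l / ε ^ r) (𝓝[>] (0 : ℝ)) (𝓝 L)

/-- `(a, b)` (as diagonal states `((a,a),(b,b))`) is a pair in `E_s`:
exactly one player deviates and the deviation is feasible. -/
def EsPair (C : ∀ i, A i → Finset (A i)) (a b : ∀ i, A i) : Prop :=
  (∃! i, a i ≠ b i) ∧ ∀ i, a i ≠ b i → b i ∈ C i (a i)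

/-- The path (list of states) of the M-straight-route through the given diagonal nodes. -/
def msrPath : List (∀ i, A i) → List ((∀ i, A i) × (∀ i, A i))
  | [] => []
  | [a] => [(a, a)]
  | a :: b :: rest => (a, a) :: (a, b) :: msrPath (b :: rest)

/-- Weight of the edge of the graph `G_R` from `z` to `z'`: the minimal resistance
among all paths of `{P^ε}` from `z` to `z'`. -/
noncomputable def edgeWeight (κ : ℝ) (U : ι → (∀ i, A i) → ℝ)
    (C : ∀ i, A i → Finset (A i)) (z z' : (∀ i, A i) × (∀ i, A i)) : ℝ :=
  sInf {r : ℝ | ∃ l, IsPath κ U C z z' l ∧ IsPathRes κ U C l r}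

/-- `y` is reachable from `x` in at most `d` constraint-feasible steps. -/
def ReachIn (C : ∀ i, A i → Finset (A i)) (i : ι) : ℕ → A i → A i → Prop
  | 0, x, y => x = y
  | d + 1, x, y => ReachIn C i d x y ∨ ∃ w, ReachIn C i d x w ∧ y ∈ C i w

/-- Inhomogeneous products: `transProd κ U C εs k0 m` is the transition matrix
`P(k0, k0 + m) = ∏_{k'=k0}^{k0+m-1} P_{k'}` of the PIPIP chain with exploration
rates `εs`. -/
noncomputable def transProd (κ : ℝ) (U : ι → (∀ i, A i) → ℝ)
    (C : ∀ i, A i → Finset (A i)) (εs : ℕ → ℝ) (k0 : ℕ) :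
    ℕ → (∀ i, A i) × (∀ i, A i) → (∀ i, A i) × (∀ i, A i) → ℝ
  | 0, z, z' => if z = z' then 1 else 0
  | m + 1, z, z' => ∑ w : (∀ i, A i) × (∀ i, A i),
      transProd κ U C εs k0 m z w * phTrans κ U C (εs (k0 + m)) w z'

/-- The PIPIP exploration rate `ε(k) = k^{-1/(n(D+1))}`. -/
noncomputable def pipipRate (n D : ℕ) (k : ℕ) : ℝ :=
  (k : ℝ) ^ (-(1 : ℝ) / ((n : ℝ) * ((D : ℝ) + 1)))

/-- Accessibility along the unperturbed chain `{P^0}`. -/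
def Accessible0 (κ : ℝ) (U : ι → (∀ i, A i) → ℝ) (C : ∀ i, A i → Finset (A i))
    (z z' : (∀ i, A i) × (∀ i, A i)) : Prop :=
  ∃ k : ℕ, 0 < phTransPow κ U C 0 k z z'

/-- A recurrent communication class of the unperturbed chain `{P^0}`. -/
def IsRecClass (κ : ℝ) (U : ι → (∀ i, A i) → ℝ) (C : ∀ i, A i → Finset (A i))
    (H : Set ((∀ i, A i) × (∀ i, A i))) : Prop :=
  H.Nonempty ∧ (∀ z ∈ H, ∀ z' ∈ H, Accessible0 κ U C z z') ∧
    (∀ z ∈ H, ∀ z', Accessible0 κ U C z z' → z' ∈ H)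

end PHPIP

section ExpPoly

/-- The real exponential polynomials `t ↦ ∑ c_r exp (r t)`, as a subalgebra of `ℝ → ℝ`. -/
noncomputable def expPoly : Subalgebra ℝ (ℝ → ℝ) :=
  Algebra.adjoin ℝ (Set.range fun r t : ℝ => Real.exp (r * t))

lemma exp_mem_expPoly (r : ℝ) : (fun t : ℝ => Real.exp (r * t)) ∈ expPoly :=
  Algebra.subset_adjoin ⟨r, rfl⟩

lemma const_mem_expPoly (c : ℝ) : (fun _ : ℝ => c) ∈ expPoly :=
  expPoly.algebraMap_mem c

lemma exists_sum_of_mem_expPoly {f : ℝ → ℝ} (hf : f ∈ expPoly) :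
    ∃ c : ℝ →₀ ℝ, f = fun t => c.sum fun r a => a * Real.exp (r * t) := by
  have h : f ∈ Submodule.span ℝ (Set.range fun r t : ℝ => Real.exp (r * t)) := by
    have hcl : (Submonoid.closure (Set.range fun r t : ℝ => Real.exp (r * t)) : Set (ℝ → ℝ)) =
        Set.range fun r t : ℝ => Real.exp (r * t) := by
      let M : Submonoid (ℝ → ℝ) :=
        { carrier := Set.range fun r t : ℝ => Real.exp (r * t)
          one_mem' := ⟨0, by ext; simp⟩
          mul_mem' := by
            rintro _ _ ⟨r, rfl⟩ ⟨s, rfl⟩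
            exact ⟨r + s, by ext t; simp [add_mul, Real.exp_add]⟩ }
      exact congrArg SetLike.coe (Submonoid.closure_eq M)
    rw [← hcl, ← Algebra.adjoin_eq_span]
    exact hf
  obtain ⟨c, rfl⟩ := Finsupp.mem_span_range_iff_exists_finsupp.1 h
  refine ⟨c, ?_⟩
  ext t
  simp [Finsupp.sum, Finset.sum_apply]

lemma exists_hasDerivAt_of_mem_expPoly {f : ℝ → ℝ} (hf : f ∈ expPoly) :
    ∃ g ∈ expPoly, ∀ t, HasDerivAt f (g t) t := by
  induction hf using Algebra.adjoin_induction with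
  | mem f hf =>
    obtain ⟨r, rfl⟩ := hf
    refine ⟨_, mul_mem (exp_mem_expPoly r) (const_mem_expPoly r), fun t => ?_⟩
    simpa using ((hasDerivAt_id t).const_mul r).exp
  | algebraMap c => exact ⟨0, zero_mem _, fun t => hasDerivAt_const t c⟩
  | add f g _ _ hf hg =>
    obtain ⟨f', hf', hf⟩ := hf
    obtain ⟨g', hg', hg⟩ := hg
    exact ⟨f' + g', add_mem hf' hg', fun t => (hf t).add (hg t)⟩
  | mul f g hfm hgm hf hg =>
    obtain ⟨f', hf', hf⟩ := hf
    obtain ⟨g', hg', hg⟩ := hg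
    exact ⟨f' * g + f * g', add_mem (mul_mem hf' hgm) (mul_mem hfm hg'),
      fun t => (hf t).mul (hg t)⟩

lemma eventually_sign_of_mem_expPoly {f : ℝ → ℝ} (hf : f ∈ expPoly) :
    (∀ᶠ t in atTop, 0 ≤ f t) ∨ ∀ᶠ t in atTop, f t ≤ 0 := by
  obtain ⟨c, rfl⟩ := exists_sum_of_mem_expPoly hf
  rcases c.support.eq_empty_or_nonempty with h | h
  · left
    simp [Finsupp.support_eq_empty.1 h]
  set R := c.support.max' h with hR
  have hRm : R ∈ c.support := c.support.max'_mem h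
  have hlim : Tendsto (fun t : ℝ => c.sum fun r a => a * Real.exp ((r - R) * t)) atTop
      (𝓝 (c R)) := by
    have : c R = ∑ r ∈ c.support, if r = R then c r else 0 := by
      rw [Finset.sum_ite_eq' c.support R]
      simp only [hRm, if_true]
    rw [this]
    refine tendsto_finsetSum _ fun r hr => ?_
    by_cases hrR : r = R
    · simp [hrR]
    · have hlt : r - R < 0 :=
        sub_neg.2 (lt_of_le_of_ne (c.support.le_max' r hr) hrR)
      simp only [hrR, if_false]
      simpa using ((Real.tendsto_exp_atBot.comp
        (tendsto_id.const_mul_atTop_of_neg hlt)).const_mul (c r))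
  have hfac : ∀ t : ℝ, (c.sum fun r a => a * Real.exp (r * t)) =
      (c.sum fun r a => a * Real.exp ((r - R) * t)) * Real.exp (R * t) := by
    intro t
    simp only [Finsupp.sum, Finset.sum_mul]
    refine Finset.sum_congr rfl fun r _ => ?_
    rw [mul_assoc, ← Real.exp_add]
    ring_nf
  simp only [hfac]
  rcases lt_or_gt_of_ne (Finsupp.mem_support_iff.1 hRm) with h0 | h0
  · right
    filter_upwards [hlim.eventually_lt_const h0] with t ht
    exact mul_nonpos_of_nonpos_of_nonneg ht.le (Real.exp_pos _).le
  · left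
    filter_upwards [hlim.eventually_const_lt h0] with t ht
    exact mul_nonneg ht.le (Real.exp_pos _).le

lemma eventually_monotone_of_div_expPoly {f N S : ℝ → ℝ} {T : ℝ} (hN : N ∈ expPoly)
    (hS : S ∈ expPoly) (hS0 : ∀ t, T ≤ t → S t ≠ 0) (hf : ∀ t, T ≤ t → f t = N t / S t) :
    ∃ T', MonotoneOn f (Ici T') ∨ AntitoneOn f (Ici T') := by
  obtain ⟨N', hN', hNd⟩ := exists_hasDerivAt_of_mem_expPoly hN
  obtain ⟨S', hS', hSd⟩ := exists_hasDerivAt_of_mem_expPoly hS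
  have hderiv : ∀ t, T ≤ t → HasDerivAt (fun t => N t / S t)
      ((N' t * S t - N t * S' t) / S t ^ 2) t := fun t ht => (hNd t).div (hSd t) (hS0 t ht)
  have hmem : N' * S - N * S' ∈ expPoly := sub_mem (mul_mem hN' hS) (mul_mem hN hS')
  have key : ∀ T', T ≤ T' →
      ContinuousOn (fun t => N t / S t) (Ici T') := fun T' h t ht =>
    (hderiv t (h.trans ht)).continuousAt.continuousWithinAt
  rcases eventually_sign_of_mem_expPoly hmem with h | h
  all_goals
    obtain ⟨T₁, hT₁⟩ := eventually_atTop.1 h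
    refine ⟨max T T₁, ?_⟩
  · left
    refine MonotoneOn.congr (f₁ := fun t => N t / S t) ?_
      fun t ht => (hf t ((le_max_left _ _).trans ht)).symm
    refine monotoneOn_of_hasDerivWithinAt_nonneg (convex_Ici _) (key _ (le_max_left _ _))
      (fun t ht => (hderiv t ?_).hasDerivWithinAt) fun t ht => ?_
    · exact (le_max_left _ _).trans (interior_subset ht)
    · exact div_nonneg (hT₁ t ((le_max_right _ _).trans (interior_subset ht))) (sq_nonneg _)
  · right
    refine AntitoneOn.congr (f₁ := fun t => N t / S t) ?_
      fun t ht => (hf t ((le_max_left _ _).trans ht)).symm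
    refine antitoneOn_of_hasDerivWithinAt_nonpos (convex_Ici _) (key _ (le_max_left _ _))
      (fun t ht => (hderiv t ?_).hasDerivWithinAt) fun t ht => ?_
    · exact (le_max_left _ _).trans (interior_subset ht)
    · exact div_nonpos_of_nonpos_of_nonneg
        (hT₁ t ((le_max_right _ _).trans (interior_subset ht))) (sq_nonneg _)

lemma det_mem_expPoly {n : Type*} [Fintype n] [DecidableEq n] {M : ℝ → Matrix n n ℝ}
    (hM : ∀ i j, (fun t => M t i j) ∈ expPoly) : (fun t => (M t).det) ∈ expPoly := by
  have : (fun t => (M t).det) = ∑ σ : Equiv.Perm n,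
      (fun _ : ℝ => ((Equiv.Perm.sign σ : ℤ) : ℝ)) * ∏ i, fun t => M t (σ i) i := by
    ext t
    simp [Matrix.det_apply', Finset.sum_apply, Finset.prod_apply]
  rw [this]
  exact sum_mem fun σ _ => mul_mem (const_mem_expPoly _) (prod_mem fun i _ => hM _ _)

end ExpPoly

section Variation

lemma MonotoneOn.exists_tendsto_of_bounded {f : ℝ → ℝ} {T d : ℝ} (hf : MonotoneOn f (Ici T))
    (hb : ∀ t, T ≤ t → f t ≤ d) : ∃ l, Tendsto f atTop (𝓝 l) := by
  have hm : Monotone fun t => f (max T t) := fun s t h =>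
    hf (mem_Ici.2 (le_max_left _ _)) (mem_Ici.2 (le_max_left _ _)) (max_le_max le_rfl h)
  refine ⟨_, (tendsto_atTop_ciSup hm ⟨d, ?_⟩).congr' ?_⟩
  · rintro _ ⟨t, rfl⟩
    exact hb _ (le_max_left _ _)
  · filter_upwards [eventually_ge_atTop T] with t ht
    rw [max_eq_right ht]

lemma summable_abs_sub_of_monotone {u : ℕ → ℝ} {l : ℝ} (hu : Monotone u)
    (hl : Tendsto u atTop (𝓝 l)) : Summable fun k => |u (k + 1) - u k| := by
  refine summable_of_sum_range_le (c := l - u 0) (fun _ => abs_nonneg _) fun n => ?_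
  simp only [abs_of_nonneg (sub_nonneg.2 (hu (Nat.le_succ _)))]
  rw [Finset.sum_range_sub]
  exact sub_le_sub_right (hu.ge_of_tendsto hl n) _

lemma summable_abs_sub_of_eventually_monotone {f : ℝ → ℝ} {T l : ℝ}
    (hf : MonotoneOn f (Ici T) ∨ AntitoneOn f (Ici T)) (hl : Tendsto f atTop (𝓝 l))
    {t : ℕ → ℝ} (ht : MonotoneOn t (Ici 1)) (ht' : Tendsto t atTop atTop) :
    Summable fun k => |f (t (k + 1)) - f (t k)| := by
  obtain ⟨K, hK⟩ := eventually_atTop.1 (ht'.eventually_ge_atTop T)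
  have hmem : ∀ k, t (k + (K + 1)) ∈ Ici T := fun k => hK _ (by omega)
  have hmono : Monotone fun k => t (k + (K + 1)) := fun a b hab =>
    ht (mem_Ici.2 (by omega)) (mem_Ici.2 (by omega)) (by omega)
  have hlim : Tendsto (fun k => f (t (k + (K + 1)))) atTop (𝓝 l) :=
    (hl.comp ht').comp (tendsto_add_atTop_nat (K + 1))
  rw [← summable_nat_add_iff (K + 1)]
  rcases hf with hf | hf
  · refine (summable_abs_sub_of_monotone (fun a b hab => hf (hmem a) (hmem b) (hmono hab))
      hlim).congr fun k => ?_
    simp only [add_right_comm]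
  · refine (summable_abs_sub_of_monotone (u := fun k => -f (t (k + (K + 1))))
      (fun a b hab => neg_le_neg (hf (hmem a) (hmem b) (hmono hab))) hlim.neg).congr fun k => ?_
    rw [← abs_neg]
    simp only [add_right_comm]
    congr 1
    ring

end Variation

section Chains

open Matrix

variable {S : Type*} [Fintype S]

/-- The transition matrix of an inhomogeneous chain from time `k` to time `k + m`. -/
noncomputable def chainProd (P : ℕ → Matrix S S ℝ) (k : ℕ) : ℕ → Matrix S S ℝ
  | 0 => 1
  | m + 1 => chainProd P k m * P (k + m)

lemma chainProd_add (P : ℕ → Matrix S S ℝ) (k m m' : ℕ) :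
    chainProd P k (m + m') = chainProd P k m * chainProd P (k + m) m' := by
  induction m' with
  | zero => simp [chainProd]
  | succ m' ih => rw [← add_assoc, chainProd, ih, chainProd, Matrix.mul_assoc, add_assoc]

/-- A matrix with nonnegative entries and unit row sums. -/
def IsStochastic (P : Matrix S S ℝ) : Prop :=
  (∀ z w, 0 ≤ P z w) ∧ ∀ z, ∑ w, P z w = 1

lemma IsStochastic.one : IsStochastic (1 : Matrix S S ℝ) :=
  ⟨fun z w => by rw [Matrix.one_apply]; split_ifs <;> simp, fun z => by simp [Matrix.one_apply]⟩

lemma IsStochastic.mul {P Q : Matrix S S ℝ} (hP : IsStochastic P) (hQ : IsStochastic Q) :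
    IsStochastic (P * Q) := by
  refine ⟨fun z w => Finset.sum_nonneg fun x _ => mul_nonneg (hP.1 _ _) (hQ.1 _ _), fun z => ?_⟩
  simp only [Matrix.mul_apply]
  rw [Finset.sum_comm]
  simp only [← Finset.mul_sum, hQ.2, mul_one, hP.2]

lemma IsStochastic.chainProd {P : ℕ → Matrix S S ℝ} (hP : ∀ k, IsStochastic (P k)) (k m : ℕ) :
    IsStochastic (chainProd P k m) := by
  induction m with
  | zero => exact .one
  | succ m ih => exact ih.mul (hP _)

lemma IsStochastic.sum_vecMul {P : Matrix S S ℝ} (hP : IsStochastic P) (v : S → ℝ) :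
    ∑ w, (v ᵥ* P) w = ∑ z, v z := by
  simp only [Matrix.vecMul, dotProduct]
  rw [Finset.sum_comm]
  simp only [← Finset.mul_sum, hP.2, mul_one]

/-- The `ℓ¹` norm of a vector. -/
noncomputable def l1 (v : S → ℝ) : ℝ := ∑ z, |v z|

lemma l1_nonneg (v : S → ℝ) : 0 ≤ l1 v := Finset.sum_nonneg fun _ _ => abs_nonneg _

lemma l1_add_le (v w : S → ℝ) : l1 (v + w) ≤ l1 v + l1 w := by
  simp only [l1, ← Finset.sum_add_distrib]
  exact Finset.sum_le_sum fun z _ => abs_add_le _ _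

/-- Doeblin contraction: if every row of `P` puts mass at least `δ` on a common state, then `P`
contracts vectors of total mass zero by the factor `1 - δ`. -/
lemma IsStochastic.l1_vecMul_le_of_minorized {P : Matrix S S ℝ} (hP : IsStochastic P) {δ : ℝ}
    {z₀ : S} (hδ : ∀ z, δ ≤ P z z₀) {v : S → ℝ} (hv : ∑ z, v z = 0) :
    l1 (v ᵥ* P) ≤ (1 - δ) * l1 v := by
  have h : ∀ w, |(v ᵥ* P) w| ≤ ∑ z, |v z| * (P z w - if w = z₀ then δ else 0) := by
    intro w
    have : (v ᵥ* P) w = ∑ z, v z * (P z w - if w = z₀ then δ else 0) := by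
      simp only [mul_sub, Finset.sum_sub_distrib, ← Finset.sum_mul, hv, zero_mul, sub_zero]
      rfl
    rw [this]
    refine (Finset.abs_sum_le_sum_abs _ _).trans_eq (Finset.sum_congr rfl fun z _ => ?_)
    rw [abs_mul, abs_of_nonneg (a := P z w - _)]
    split_ifs with hw
    · exact hw ▸ sub_nonneg.2 (hδ z)
    · simpa using hP.1 z w
  refine (Finset.sum_le_sum fun w _ => h w).trans_eq ?_
  rw [Finset.sum_comm]
  simp only [← Finset.mul_sum, Finset.sum_sub_distrib, hP.2, Finset.sum_ite_eq', Finset.mem_univ,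
    if_true, ← Finset.sum_mul]
  rw [mul_comm, l1]

lemma IsStochastic.l1_vecMul_le {P : Matrix S S ℝ} (hP : IsStochastic P) (v : S → ℝ) :
    l1 (v ᵥ* P) ≤ l1 v := by
  have h : ∀ w, |(v ᵥ* P) w| ≤ ∑ z, |v z| * P z w := by
    intro w
    refine (Finset.abs_sum_le_sum_abs _ _).trans_eq (Finset.sum_congr rfl fun z _ => ?_)
    rw [abs_mul, abs_of_nonneg (hP.1 z w)]
  refine (Finset.sum_le_sum fun w _ => h w).trans_eq ?_
  rw [Finset.sum_comm]
  simp only [← Finset.mul_sum, hP.2, mul_one, l1]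

/-- If `e` is almost decreasing and contracts at non-summable rate, it tends to zero. -/
lemma tendsto_zero_of_contracting {e v δ : ℕ → ℝ} {L : ℕ} (he : ∀ k, 0 ≤ e k)
    (hv0 : ∀ k, 0 ≤ v k) (hv : Summable v) (hδ0 : ∀ k, 0 ≤ δ k) (hδ : ¬ Summable δ)
    (h1 : ∀ k, e (k + 1) ≤ e k + v k)
    (h2 : ∀ k, e (k + L) ≤ (1 - δ k) * e k + ∑ i ∈ Finset.range L, v (k + i)) :
    Tendsto e atTop (𝓝 0) := by
  set s : ℕ → ℝ := fun k => ∑ i ∈ Finset.range k, v i with hs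
  have hsl : Tendsto s atTop (𝓝 (∑' i, v i)) := hv.hasSum.tendsto_sum_nat
  have hsle : ∀ k, s k ≤ ∑' i, v i := fun k => hv.sum_le_tsum _ fun i _ => hv0 i
  have hanti : Antitone fun k => e k - s k := by
    refine antitone_nat_of_succ_le fun k => ?_
    simp only [hs, Finset.sum_range_succ]
    linarith [h1 k]
  have hbdd : BddBelow (range fun k => e k - s k) := by
    refine ⟨-∑' i, v i, ?_⟩
    rintro _ ⟨k, rfl⟩
    show _ ≤ e k - s k
    linarith [he k, hsle k]
  obtain ⟨l, hl⟩ : ∃ l, Tendsto e atTop (𝓝 l) :=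
    ⟨_, ((tendsto_atTop_ciInf hanti hbdd).add hsl).congr fun k => by ring⟩
  have hl0 : 0 ≤ l := ge_of_tendsto' hl he
  rcases hl0.eq_or_lt with h0 | h0
  · rwa [h0]
  exfalso
  have hV : Summable fun k => ∑ i ∈ Finset.range L, v (k + i) :=
    summable_sum fun i _ => (summable_nat_add_iff i).2 hv
  have hde : Summable fun k => δ k * e k := by
    refine summable_of_sum_range_le
      (c := ∑ k ∈ Finset.range L, e k + ∑' k, ∑ i ∈ Finset.range L, v (k + i))
      (fun k => mul_nonneg (hδ0 k) (he k)) fun n => ?_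
    have hle : ∑ k ∈ Finset.range n, δ k * e k ≤ ∑ k ∈ Finset.range n,
        (e k - e (k + L) + ∑ i ∈ Finset.range L, v (k + i)) :=
      Finset.sum_le_sum fun k _ => by linarith [h2 k]
    refine hle.trans ?_
    rw [Finset.sum_add_distrib, Finset.sum_sub_distrib]
    refine add_le_add ?_ (hV.sum_le_tsum _ fun k _ => Finset.sum_nonneg fun i _ => hv0 _)
    have e1 : ∑ k ∈ Finset.range (L + n), e k =
        ∑ k ∈ Finset.range L, e k + ∑ k ∈ Finset.range n, e (k + L) := by
      rw [Finset.sum_range_add]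
      simp only [add_comm]
    have e2 : ∑ k ∈ Finset.range (n + L), e k =
        ∑ k ∈ Finset.range n, e k + ∑ k ∈ Finset.range L, e (n + k) := Finset.sum_range_add _ _ _
    have e3 : 0 ≤ ∑ k ∈ Finset.range L, e (n + k) := Finset.sum_nonneg fun _ _ => he _
    rw [add_comm n L] at e2
    linarith
  refine hδ (Summable.of_norm_bounded_eventually_nat (hde.mul_left (2 / l)) ?_)
  filter_upwards [hl.eventually_const_lt (half_lt_self h0)] with k hk
  rw [Real.norm_eq_abs, abs_of_nonneg (hδ0 k)]
  have : 1 ≤ 2 / l * e k := by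
    rw [div_mul_eq_mul_div, le_div_iff₀ h0]
    linarith
  nlinarith [mul_le_mul_of_nonneg_left this (hδ0 k)]

lemma tendsto_of_chain_of_stationary {P : ℕ → Matrix S S ℝ} (hP : ∀ k, IsStochastic (P k))
    {y ρ : ℕ → S → ℝ} {ρ' : S → ℝ} (hy : ∀ k, y (k + 1) = y k ᵥ* P k) (hy0 : ∑ z, y 0 z = 1)
    (hρ1 : ∀ k, ∑ z, ρ k z = 1) (hρP : ∀ k, ρ k ᵥ* P k = ρ k)
    (hρv : ∀ z, Summable fun k => |ρ (k + 1) z - ρ k z|)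
    (hρl : ∀ z, Tendsto (fun k => ρ k z) atTop (𝓝 (ρ' z)))
    {δ : ℕ → ℝ} (hδ0 : ∀ k, 0 ≤ δ k) (hδ : ¬ Summable δ) {L : ℕ} {z₀ : S}
    (hmin : ∀ k z, δ k ≤ chainProd P k L z z₀) (z : S) :
    Tendsto (fun k => y k z) atTop (𝓝 (ρ' z)) := by
  have hy1 : ∀ k, ∑ z, y k z = 1 := by
    intro k
    induction k with
    | zero => exact hy0
    | succ k ih => rw [hy, (hP k).sum_vecMul, ih]
  set v : ℕ → ℝ := fun k => l1 (ρ k - ρ (k + 1)) with hv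
  have hstep : ∀ k, y (k + 1) - ρ (k + 1) = (y k - ρ k) ᵥ* P k + (ρ k - ρ (k + 1)) := by
    intro k
    rw [hy, Matrix.sub_vecMul, hρP]
    abel
  have h1 : ∀ k, l1 (y (k + 1) - ρ (k + 1)) ≤ l1 (y k - ρ k) + v k := by
    intro k
    rw [hstep]
    exact (l1_add_le _ _).trans (add_le_add_left ((hP k).l1_vecMul_le _) _)
  have hblock : ∀ k m, l1 (y (k + m) - ρ (k + m) - (y k - ρ k) ᵥ* chainProd P k m) ≤
      ∑ i ∈ Finset.range m, v (k + i) := by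
    intro k m
    induction m with
    | zero => simp [chainProd, l1]
    | succ m ih =>
      have : y (k + (m + 1)) - ρ (k + (m + 1)) - (y k - ρ k) ᵥ* chainProd P k (m + 1) =
          (y (k + m) - ρ (k + m) - (y k - ρ k) ᵥ* chainProd P k m) ᵥ* P (k + m) +
            (ρ (k + m) - ρ (k + m + 1)) := by
        rw [← add_assoc, hstep, chainProd, Matrix.sub_vecMul _ (y (k + m) - ρ (k + m)),
          Matrix.vecMul_vecMul]
        abel
      rw [this, Finset.sum_range_succ]
      exact (l1_add_le _ _).trans (add_le_add_left (((hP _).l1_vecMul_le _).trans ih) _)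
  have h2 : ∀ k, l1 (y (k + L) - ρ (k + L)) ≤
      (1 - δ k) * l1 (y k - ρ k) + ∑ i ∈ Finset.range L, v (k + i) := by
    intro k
    have hz : ∑ z, (y k - ρ k) z = 0 := by
      simp [Finset.sum_sub_distrib, hy1, hρ1]
    have := l1_add_le ((y k - ρ k) ᵥ* chainProd P k L)
      (y (k + L) - ρ (k + L) - (y k - ρ k) ᵥ* chainProd P k L)
    rw [add_sub_cancel] at this
    exact this.trans (add_le_add
      ((IsStochastic.chainProd hP k L).l1_vecMul_le_of_minorized (hmin k) hz) (hblock k L))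
  have hvs : Summable v := by
    refine summable_sum fun z _ => (hρv z).congr fun k => ?_
    rw [abs_sub_comm]
    rfl
  have he := tendsto_zero_of_contracting (fun k => l1_nonneg (y k - ρ k)) (fun k => l1_nonneg _)
    hvs hδ0 hδ h1 h2
  have hd : Tendsto (fun k => y k z - ρ k z) atTop (𝓝 0) :=
    squeeze_zero_norm (fun k => Finset.single_le_sum (f := fun z => |(y k - ρ k) z|)
      (fun _ _ => abs_nonneg _) (Finset.mem_univ z)) he
  simpa using hd.add (hρl z)

/-- Strong ergodicity of an inhomogeneous chain whose stationary vectors have bounded variation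
and which satisfies a Doeblin condition with non-summable weights. -/
theorem strongly_ergodic_of_doeblin {P : ℕ → Matrix S S ℝ} (hP : ∀ k, IsStochastic (P k))
    {ρ : ℕ → S → ℝ} {ρ' : S → ℝ} {K : ℕ} (hρ1 : ∀ k, K ≤ k → ∑ z, ρ k z = 1)
    (hρP : ∀ k, K ≤ k → ρ k ᵥ* P k = ρ k) (hρv : ∀ z, Summable fun k => |ρ (k + 1) z - ρ k z|)
    (hρl : ∀ z, Tendsto (fun k => ρ k z) atTop (𝓝 (ρ' z)))
    {δ : ℕ → ℝ} (hδ0 : ∀ k, 0 ≤ δ k) (hδ : ¬ Summable δ) {L : ℕ} {z₀ : S}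
    (hmin : ∀ k, K ≤ k → ∀ z, δ k ≤ chainProd P k L z z₀)
    {ν : S → ℝ} (hν : ∑ z, ν z = 1) (k₀ : ℕ) (z : S) :
    Tendsto (fun k => (ν ᵥ* chainProd P k₀ (k - k₀)) z) atTop (𝓝 (ρ' z)) := by
  have hshift : ∀ K₁ k m, chainProd (fun j => P (K₁ + j)) k m = chainProd P (K₁ + k) m := by
    intro K₁ k m
    induction m with
    | zero => rfl
    | succ m ih => rw [chainProd, ih, chainProd, add_assoc]
  set K₁ := max K k₀ with hK₁
  have hK : K ≤ K₁ := le_max_left _ _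
  have hk₀ : k₀ ≤ K₁ := le_max_right _ _
  rw [← tendsto_add_atTop_iff_nat K₁]
  refine tendsto_of_chain_of_stationary (P := fun j => P (K₁ + j))
    (y := fun j => ν ᵥ* chainProd P k₀ (j + K₁ - k₀)) (ρ := fun j => ρ (K₁ + j))
    (δ := fun j => δ (K₁ + j)) (L := L) (z₀ := z₀)
    (fun k => hP _) (fun j => ?_) ?_ (fun k => hρ1 _ (by omega)) (fun k => hρP _ (by omega))
    (fun z => ?_) (fun z => ?_) (fun k => hδ0 _) ?_ (fun k z => ?_) z
  · rw [Matrix.vecMul_vecMul]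
    have : j + 1 + K₁ - k₀ = (j + K₁ - k₀) + 1 := by omega
    rw [this, chainProd]
    have : k₀ + (j + K₁ - k₀) = K₁ + j := by omega
    rw [this]
  · rw [(IsStochastic.chainProd hP _ _).sum_vecMul, hν]
  · simpa only [add_comm K₁, add_right_comm, ← add_assoc] using (summable_nat_add_iff K₁).2 (hρv z)
  · simpa only [add_comm] using (tendsto_add_atTop_iff_nat K₁).2 (hρl z)
  · simpa only [add_comm] using (summable_nat_add_iff K₁).not.2 hδ
  · rw [hshift]
    exact hmin _ (by omega) z

/-- The matrix `1 - P + J`, with `J` the all-ones matrix, whose inverse yields the stationary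
vector of `P`. -/
noncomputable def fundMatrix (P : Matrix S S ℝ) : Matrix S S ℝ :=
  1 - P + Matrix.of fun _ _ => 1

lemma vecMul_fundMatrix (P : Matrix S S ℝ) (v : S → ℝ) :
    v ᵥ* fundMatrix P = v - v ᵥ* P + fun _ => ∑ z, v z := by
  rw [fundMatrix, Matrix.vecMul_add, Matrix.vecMul_sub, Matrix.vecMul_one]
  congr 1
  ext w
  simp [Matrix.vecMul, dotProduct]

lemma fundMatrix_det_ne_zero {P : Matrix S S ℝ} (hP : IsStochastic P) {δ : ℝ} (hδ : 0 < δ)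
    {L : ℕ} {z₀ : S} (hmin : ∀ z, δ ≤ chainProd (fun _ => P) 0 L z z₀) :
    (fundMatrix P).det ≠ 0 := by
  intro hdet
  obtain ⟨v, hv0, hv⟩ := Matrix.exists_vecMul_eq_zero_iff.2 hdet
  rw [vecMul_fundMatrix] at hv
  have hsum : ∑ z, v z = 0 := by
    have h := congrArg (fun f : S → ℝ => ∑ w, f w) hv
    simp only [Pi.add_apply, Pi.sub_apply, Finset.sum_add_distrib, Finset.sum_sub_distrib,
      hP.sum_vecMul, Finset.sum_const, Pi.zero_apply] at h
    have hne : Fintype.card S ≠ 0 := Finset.card_ne_zero_of_mem (Finset.mem_univ z₀)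
    simpa [hne] using h
  have hfix : v ᵥ* P = v := by
    have : v - v ᵥ* P = 0 := by
      rw [← hv, hsum]
      ext
      simp
    exact (sub_eq_zero.1 this).symm
  have hfixL : ∀ m, v ᵥ* chainProd (fun _ => P) 0 m = v := by
    intro m
    induction m with
    | zero => simp [chainProd]
    | succ m ih => rw [chainProd, ← Matrix.vecMul_vecMul, ih, hfix]
  have hle := (IsStochastic.chainProd (fun _ => hP) 0 L).l1_vecMul_le_of_minorized hmin hsum
  rw [hfixL] at hle
  have h0 : l1 v = 0 := le_antisymm (by nlinarith [l1_nonneg v]) (l1_nonneg v)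
  refine hv0 (funext fun z => abs_eq_zero.1 ?_)
  exact (Finset.sum_eq_zero_iff_of_nonneg fun _ _ => abs_nonneg _).1 h0 z (Finset.mem_univ z)

lemma stationary_eq_div {P : Matrix S S ℝ} (hdet : (fundMatrix P).det ≠ 0) {v : S → ℝ}
    (hv1 : ∑ z, v z = 1) (hv : v ᵥ* P = v) (z : S) :
    v z = ((fundMatrix P).updateRow z fun _ => 1).det / (fundMatrix P).det := by
  rw [eq_div_iff hdet, ← Matrix.cramer_transpose_apply]
  have h : (fundMatrix P)ᵀ *ᵥ v = fun _ => 1 := by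
    rw [Matrix.mulVec_transpose, vecMul_fundMatrix, hv, hv1]
    ext
    simp
  rw [← h, Matrix.cramer_eq_adjugate_mulVec, Matrix.mulVec_mulVec, Matrix.adjugate_mul,
    Matrix.det_transpose, Matrix.smul_mulVec, Matrix.one_mulVec, Pi.smul_apply, smul_eq_mul,
    mul_comm]

/-- Along a curve of stochastic matrices whose entries are exponential polynomials, and which
satisfy a Doeblin condition, each coordinate of the stationary vector is eventually monotone. -/
lemma eventually_monotone_stationary {T : ℝ} {P : ℝ → Matrix S S ℝ} {v : ℝ → S → ℝ}
    (hent : ∀ z w, (fun t => P t z w) ∈ expPoly) (hP : ∀ t, T ≤ t → IsStochastic (P t))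
    {L : ℕ} {z₀ : S}
    (hmin : ∀ t, T ≤ t → ∃ δ : ℝ, 0 < δ ∧ ∀ z, δ ≤ chainProd (fun _ => P t) 0 L z z₀)
    (hv1 : ∀ t, T ≤ t → ∑ z, v t z = 1) (hv : ∀ t, T ≤ t → v t ᵥ* P t = v t) (z : S) :
    ∃ T', MonotoneOn (fun t => v t z) (Ici T') ∨ AntitoneOn (fun t => v t z) (Ici T') := by
  have hdet : ∀ t, T ≤ t → (fundMatrix (P t)).det ≠ 0 := fun t ht => by
    obtain ⟨δ, hδ, h⟩ := hmin t ht
    exact fundMatrix_det_ne_zero (hP t ht) hδ h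
  have hfund : ∀ i j, (fun t => fundMatrix (P t) i j) ∈ expPoly := fun i j =>
    add_mem (sub_mem (const_mem_expPoly ((1 : Matrix S S ℝ) i j)) (hent i j))
      (const_mem_expPoly 1)
  refine eventually_monotone_of_div_expPoly (det_mem_expPoly fun i j => ?_)
    (det_mem_expPoly hfund) hdet fun t ht => stationary_eq_div (hdet t ht) (hv1 t ht) (hv t ht) z
  by_cases hi : i = z
  · subst hi
    simpa using const_mem_expPoly 1
  · simpa only [Matrix.updateRow_ne hi] using hfund i j

end Chains

section Selection

variable {ι : Type*} {A : ι → Type*}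
  {κ : ℝ} {U : ι → (∀ i, A i) → ℝ} {C : ∀ i, A i → Finset (A i)}

lemma two_le_card_erase (hC : ∀ i (a : A i), 3 ≤ (C i a).card) (i : ι) (a : A i) :
    2 ≤ ((C i a).erase a).card := by
  have := Finset.pred_card_le_card_erase (s := C i a) (a := a)
  have := hC i a
  omega

lemma one_le_card_erase_erase (hC : ∀ i (a : A i), 3 ≤ (C i a).card) (i : ι) (a b : A i) :
    1 ≤ (((C i a).erase a).erase b).card := by
  have := Finset.pred_card_le_card_erase (s := (C i a).erase a) (a := b)
  have := two_le_card_erase hC i a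
  omega

lemma mul_rpow_mem_Icc (hκ0 : 0 < κ) (hκ2 : κ ≤ 1 / 2) {ε d : ℝ} (hε0 : 0 ≤ ε) (hε1 : ε ≤ 1)
    (hd : 0 < d) : 0 ≤ κ * ε ^ d ∧ κ * ε ^ d ≤ 1 / 2 := by
  have h0 : 0 ≤ ε ^ d := Real.rpow_nonneg hε0 _
  have h1 : ε ^ d ≤ 1 := Real.rpow_le_one hε0 hε1 hd.le
  exact ⟨by positivity, by nlinarith⟩

lemma selProb_nonneg (hκ0 : 0 < κ) (hκ2 : κ ≤ 1 / 2) {ε : ℝ} (hε0 : 0 ≤ ε) (hε1 : ε ≤ 1)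
    (a0 a1 : ∀ i, A i) (i : ι) (x : A i) : 0 ≤ selProb κ U C ε a0 a1 i x := by
  have h1 : 0 ≤ 1 - ε := by linarith
  unfold selProb
  split_ifs with h <;> try positivity
  all_goals
    obtain ⟨h2, h3⟩ := mul_rpow_mem_Icc hκ0 hκ2 hε0 hε1 (sub_pos.2 (not_le.1 h))
    have h4 : 0 ≤ 1 - κ * ε ^ (U i a0 - U i a1) := by linarith
    positivity

variable {ε : ℝ} {a0 a1 : ∀ i, A i} {i : ι}

lemma half_le_selProb_stay (hε2 : ε ≤ 1 / 2) (h : U i a0 ≤ U i a1) :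
    1 / 2 ≤ selProb κ U C ε a0 a1 i (a1 i) := by
  simp only [selProb, h, if_true, Finset.notMem_erase, if_false]
  linarith

lemma quarter_le_selProb_revert (hκ0 : 0 < κ) (hκ2 : κ ≤ 1 / 2) (hε0 : 0 < ε)
    (hε2 : ε ≤ 1 / 2) (h : U i a1 < U i a0) :
    1 / 4 ≤ selProb κ U C ε a0 a1 i (a0 i) := by
  obtain ⟨h2, h3⟩ := mul_rpow_mem_Icc hκ0 hκ2 hε0.le (by linarith) (sub_pos.2 h)
  simp only [selProb, not_le.2 h, if_true, Finset.notMem_erase, if_false]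
  split_ifs <;> nlinarith

lemma half_le_selProb_of_eq (hε2 : ε ≤ 1 / 2) (h : a0 i = a1 i) :
    1 / 2 ≤ selProb κ U C ε a0 a1 i (a1 i) := by
  simp only [selProb, h, if_true, Finset.notMem_erase, if_false]
  split_ifs <;> linarith

lemma le_selProb_explore (hκ0 : 0 < κ) (hκ2 : κ ≤ 1 / 2) (hε0 : 0 < ε)
    (hε2 : ε ≤ 1 / 2) {x : A i} (hx : x ∈ C i (a1 i)) (hne : x ≠ a1 i) :
    1 / (4 * (C i (a1 i)).card) * ε ≤ selProb κ U C ε a0 a1 i x := by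
  have hcard : (1 : ℝ) ≤ (C i (a1 i)).card := by
    exact_mod_cast Finset.card_pos.2 ⟨x, hx⟩
  have key : ∀ s : Finset (A i), x ∈ s → s ⊆ C i (a1 i) →
      1 / (4 * (C i (a1 i)).card) * ε ≤ ε / s.card := by
    intro s hxs hs
    have h1 : (1 : ℝ) ≤ s.card := by exact_mod_cast Finset.card_pos.2 ⟨x, hxs⟩
    have h2 : (s.card : ℝ) ≤ (C i (a1 i)).card := by exact_mod_cast Finset.card_le_card hs
    rw [div_mul_eq_mul_div, one_mul]
    gcongr
    linarith
  have hmem : x ∈ (C i (a1 i)).erase (a1 i) := Finset.mem_erase.2 ⟨hne, hx⟩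
  by_cases h : U i a0 ≤ U i a1
  · simp only [selProb, h, if_true, hne, if_false, hmem, zero_add]
    exact key _ hmem (Finset.erase_subset _ _)
  · by_cases hx0 : x = a0 i
    · have hq := quarter_le_selProb_revert (C := C) hκ0 hκ2 hε0 hε2 (not_le.1 h)
      rw [hx0]
      refine le_trans ?_ hq
      rw [div_mul_eq_mul_div, div_le_div_iff₀ (by positivity) (by norm_num)]
      nlinarith
    · have hmem' := Finset.mem_erase.2 ⟨hx0, hmem⟩
      simp only [selProb, h, hne, if_false, hmem', hx0, zero_add, if_true]
      exact key _ hmem' ((Finset.erase_subset _ _).trans (Finset.erase_subset _ _))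

lemma le_selProb_stay (hκ0 : 0 < κ) (hκ2 : κ ≤ 1 / 2) (hε0 : 0 < ε)
    (hε2 : ε ≤ 1 / 2) (hd : U i a0 - U i a1 ≤ 1) :
    κ / 2 * ε ≤ selProb κ U C ε a0 a1 i (a1 i) := by
  by_cases h : U i a0 ≤ U i a1
  · exact le_trans (by nlinarith) (half_le_selProb_stay hε2 h)
  · obtain ⟨h2, h3⟩ :=
      mul_rpow_mem_Icc hκ0 hκ2 hε0.le (by linarith) (sub_pos.2 (not_le.1 h))
    have h4 : ε ≤ ε ^ (U i a0 - U i a1) := by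
      simpa using Real.rpow_le_rpow_of_exponent_ge hε0 (by linarith) hd
    have h5 : κ / 2 * ε ≤ (1 - ε) * (κ * ε ^ (U i a0 - U i a1)) := by
      have h6 : κ * ε ≤ κ * ε ^ (U i a0 - U i a1) := by gcongr
      nlinarith
    simp only [selProb, h, if_true, if_false, Finset.mem_erase, ne_eq, not_true, false_and,
      and_false]
    split_ifs <;> nlinarith

variable [∀ i, Fintype (A i)]

lemma sum_ite_mem_div_card {α : Type*} [Fintype α] (s : Finset α) (hs : 1 ≤ s.card) (ε : ℝ) :
    ∑ x, (if x ∈ s then ε / s.card else 0) = ε := by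
  rw [Finset.sum_ite_mem, Finset.univ_inter, Finset.sum_const, nsmul_eq_mul]
  have : (s.card : ℝ) ≠ 0 := by
    have : s.card ≠ 0 := by omega
    exact_mod_cast this
  field_simp

lemma sum_selProb (hC : ∀ i (a : A i), 3 ≤ (C i a).card) (ε : ℝ) (a0 a1 : ∀ i, A i) (i : ι) :
    ∑ x, selProb κ U C ε a0 a1 i x = 1 := by
  unfold selProb
  split_ifs with h
  · rw [Finset.sum_add_distrib, sum_ite_mem_div_card _
      (one_le_two.trans (two_le_card_erase hC i _))]
    simp
  · rw [Finset.sum_add_distrib, Finset.sum_add_distrib,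
      sum_ite_mem_div_card _ (one_le_card_erase_erase hC i _ _)]
    simp only [Finset.sum_ite_eq', Finset.mem_univ, if_true]
    ring

variable [Fintype ι] [DecidableEq ι]

lemma isStochastic_phTrans (hC : ∀ i (a : A i), 3 ≤ (C i a).card) (hκ0 : 0 < κ)
    (hκ2 : κ ≤ 1 / 2) {ε : ℝ} (hε0 : 0 ≤ ε) (hε1 : ε ≤ 1) :
    IsStochastic (Matrix.of (phTrans κ U C ε)) := by
  refine ⟨fun z w => ?_, fun z => ?_⟩
  · simp only [Matrix.of_apply, phTrans]
    split_ifs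
    · exact Finset.prod_nonneg fun i _ => selProb_nonneg hκ0 hκ2 hε0 hε1 _ _ _ _
    · exact le_rfl
  · simp only [Matrix.of_apply, phTrans, Fintype.sum_prod_type]
    rw [Finset.sum_comm]
    simp only [Finset.sum_ite_eq', Finset.mem_univ, if_true]
    have h := Finset.prod_univ_sum (fun i => (Finset.univ : Finset (A i)))
      fun i x => selProb κ U C ε z.1 z.2 i x
    simp only [sum_selProb hC, Finset.prod_const_one] at h
    rw [h]
    exact Finset.sum_congr (by ext; simp) fun _ _ => rfl

lemma transProd_eq_chainProd (εs : ℕ → ℝ) (k m : ℕ) (z z' : (∀ i, A i) × (∀ i, A i)) :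
    transProd κ U C εs k m z z' =
      chainProd (fun j => Matrix.of (phTrans κ U C (εs j))) k m z z' := by
  induction m generalizing z' with
  | zero =>
    by_cases h : z = z' <;> simp [transProd, chainProd, Matrix.one_apply, h]
  | succ m ih => simp only [transProd, chainProd, Matrix.mul_apply, ih, Matrix.of_apply]

end Selection

section Settle

variable {ι : Type*} {A : ι → Type*} {U : ι → (∀ i, A i) → ℝ}

/-- The most likely successor of a state: players whose utility decreased revert, the others keep
their action. -/
noncomputable def settle (U : ι → (∀ i, A i) → ℝ) (z : (∀ i, A i) × (∀ i, A i)) :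
    (∀ i, A i) × (∀ i, A i) :=
  (z.2, fun i => if U i z.1 ≤ U i z.2 then z.2 i else z.1 i)

lemma settle_diag (a : ∀ i, A i) : settle U (a, a) = (a, a) := by simp [settle]

end Settle

section Minorization

variable {ι : Type*} [Fintype ι] [DecidableEq ι] {A : ι → Type*} [∀ i, Fintype (A i)]

/-- The `L`-step transition probability from `z` to `z'` is at least of order `e ^ m`, whenever the
exploration rates in force lie in `[e, 1/2]`. -/
def Minorized (κ : ℝ) (U : ι → (∀ i, A i) → ℝ) (C : ∀ i, A i → Finset (A i)) (L m : ℕ)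
    (z z' : (∀ i, A i) × (∀ i, A i)) : Prop :=
  ∃ c : ℝ, 0 < c ∧ ∀ (εs : ℕ → ℝ) (k : ℕ) (e : ℝ), (∀ j, 0 ≤ εs j ∧ εs j ≤ 1) → 0 < e → e ≤ 1 →
    (∀ j < L, e ≤ εs (k + j) ∧ εs (k + j) ≤ 1 / 2) →
    c * e ^ m ≤ chainProd (fun j => Matrix.of (phTrans κ U C (εs j))) k L z z'

variable {κ : ℝ} {U : ι → (∀ i, A i) → ℝ} {C : ∀ i, A i → Finset (A i)}
  {z z' z'' : (∀ i, A i) × (∀ i, A i)} {L L' m m' : ℕ}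

lemma Minorized.refl (z : (∀ i, A i) × (∀ i, A i)) : Minorized κ U C 0 0 z z :=
  ⟨1, one_pos, fun εs k e _ _ _ _ => by simp [chainProd]⟩

lemma Minorized.mono (h : Minorized κ U C L m z z') (hm : m ≤ m') :
    Minorized κ U C L m' z z' := by
  obtain ⟨c, hc, h⟩ := h
  refine ⟨c, hc, fun εs k e h01 he he1 hεs => le_trans ?_ (h εs k e h01 he he1 hεs)⟩
  exact mul_le_mul_of_nonneg_left (pow_le_pow_of_le_one he.le he1 hm) hc.le

lemma Minorized.trans (hC : ∀ i (a : A i), 3 ≤ (C i a).card) (hκ0 : 0 < κ) (hκ2 : κ ≤ 1 / 2)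
    (h : Minorized κ U C L m z z') (h' : Minorized κ U C L' m' z' z'') :
    Minorized κ U C (L + L') (m + m') z z'' := by
  obtain ⟨c, hc, h⟩ := h
  obtain ⟨c', hc', h'⟩ := h'
  refine ⟨c * c', mul_pos hc hc', fun εs k e h01 he he1 hεs => ?_⟩
  have hP : ∀ j, IsStochastic (Matrix.of (phTrans κ U C (εs j))) := fun j =>
    isStochastic_phTrans hC hκ0 hκ2 (h01 j).1 (h01 j).2
  have h1 := h εs k e h01 he he1 fun j hj => hεs j (by omega)
  have h2 := h' εs (k + L) e h01 he he1 fun j hj => by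
    rw [add_assoc]
    exact hεs _ (by omega)
  rw [chainProd_add, Matrix.mul_apply]
  refine le_trans ?_ (Finset.single_le_sum (fun w _ => mul_nonneg
    ((IsStochastic.chainProd hP _ _).1 _ _) ((IsStochastic.chainProd hP _ _).1 _ _))
    (Finset.mem_univ z'))
  calc c * c' * e ^ (m + m') = (c * e ^ m) * (c' * e ^ m') := by ring
    _ ≤ _ := mul_le_mul h1 h2 (by positivity) ((IsStochastic.chainProd hP _ _).1 _ _)

lemma Minorized.of_phTrans {c : ℝ} (hc : 0 < c)
    (h : ∀ ε : ℝ, 0 < ε → ε ≤ 1 / 2 → c * ε ^ m ≤ phTrans κ U C ε z z') :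
    Minorized κ U C 1 m z z' := by
  refine ⟨c, hc, fun εs k e h01 he he1 hεs => ?_⟩
  obtain ⟨h1, h2⟩ := hεs 0 one_pos
  simp only [chainProd, Matrix.one_mul, Matrix.of_apply]
  refine le_trans ?_ (h _ (he.trans_le h1) h2)
  gcongr

lemma minorized_settle (hκ0 : 0 < κ) (hκ2 : κ ≤ 1 / 2) (z : (∀ i, A i) × (∀ i, A i)) :
    Minorized κ U C 1 0 z (settle U z) := by
  refine .of_phTrans (c := ∏ _i : ι, 1 / 4) (by positivity) fun ε hε0 hε2 => ?_
  rw [pow_zero, mul_one]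
  simp only [phTrans, settle, if_true]
  refine Finset.prod_le_prod (fun _ _ => by norm_num) fun i _ => ?_
  split_ifs with h
  · exact le_trans (by norm_num) (half_le_selProb_stay hε2 h)
  · exact quarter_le_selProb_revert hκ0 hκ2 hε0 hε2 (not_le.1 h)

lemma minorized_diag (hC : ∀ i (a : A i), 3 ≤ (C i a).card) (hκ0 : 0 < κ) (hκ2 : κ ≤ 1 / 2)
    (a : ∀ i, A i) (L : ℕ) : Minorized κ U C L 0 (a, a) (a, a) := by
  induction L with
  | zero => exact .refl _
  | succ L ih =>
    have h := minorized_settle (U := U) (C := C) hκ0 hκ2 (a, a)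
    rw [settle_diag] at h
    exact ih.trans hC hκ0 hκ2 h

lemma exists_minorized_to_diag (hC : ∀ i (a : A i), 3 ≤ (C i a).card) (hκ0 : 0 < κ)
    (hκ2 : κ ≤ 1 / 2) (z : (∀ i, A i) × (∀ i, A i)) :
    ∃ L a, Minorized κ U C L 0 z (a, a) := by
  let F : (∀ i, A i) × (∀ i, A i) → Finset ι := fun z => Finset.univ.filter fun i => z.1 i ≠ z.2 i
  have hF : ∀ z, F (settle U z) ⊆ F z := by
    intro z i
    simp only [F, Finset.mem_filter, Finset.mem_univ, true_and, settle]
    intro h h'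
    simp [h'] at h
  induction hn : (F z).card using Nat.strong_induction_on generalizing z with
  | _ n ih =>
    rcases (F z).eq_empty_or_nonempty with h0 | ⟨i, hi⟩
    · have : z = (z.2, z.2) := by
        refine Prod.ext (funext fun i => ?_) rfl
        by_contra h
        exact Finset.notMem_empty i (h0 ▸ Finset.mem_filter.2 ⟨Finset.mem_univ _, h⟩)
      exact ⟨0, z.2, this ▸ .refl _⟩
    · have hss : F (settle U (settle U z)) ⊂ F z := by
        refine lt_of_le_of_ne ((hF _).trans (hF _)) fun heq => ?_
        have h1 : F (settle U z) = F z := (hF z).antisymm (heq ▸ hF (settle U z))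
        have hrev : (settle U z).2 = z.1 := by
          ext j
          by_cases hj : j ∈ F z
          · have := h1 ▸ hj
            simp only [F, Finset.mem_filter, Finset.mem_univ, true_and, settle] at this ⊢
            split_ifs with h
            · simp [h] at this
            · rfl
          · have : z.1 j = z.2 j := by simpa [F] using hj
            simp [settle, this]
        have hlt : U i z.2 < U i z.1 := by
          have := h1 ▸ hi
          simp only [F, Finset.mem_filter, Finset.mem_univ, true_and, settle] at this
          by_contra h
          simp [not_lt.1 h] at this
        have hi2 := heq ▸ hi
        have e1 : (settle U z).1 = z.2 := rfl
        simp only [F, Finset.mem_filter, Finset.mem_univ, true_and] at hi2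
        rw [settle, hrev, e1] at hi2
        simp [hlt.le] at hi2
      obtain ⟨L, a, h⟩ := ih _ (hn ▸ Finset.card_lt_card hss) _ rfl
      exact ⟨_, a, ((minorized_settle hκ0 hκ2 z).trans hC hκ0 hκ2
        (minorized_settle hκ0 hκ2 _)).trans hC hκ0 hκ2 h⟩

lemma minorized_of_single {i : ι} {w x y : A i} {a : ∀ i, A i} {c : ℝ} (hc : 0 < c)
    (h : ∀ ε : ℝ, 0 < ε → ε ≤ 1 / 2 →
      c * ε ≤ selProb κ U C ε (Function.update a i w) (Function.update a i x) i y) :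
    Minorized κ U C 1 1 (Function.update a i w, Function.update a i x)
      (Function.update a i x, Function.update a i y) := by
  refine .of_phTrans (c := c * ∏ _i : ι, 1 / 2) (by positivity) fun ε hε0 hε2 => ?_
  have hsplit : c * (∏ _i : ι, (1 : ℝ) / 2) * ε ^ 1 =
      ∏ j : ι, ((if j = i then c * ε else 1) * (1 / 2)) := by
    rw [Finset.prod_mul_distrib, Finset.prod_ite_eq' Finset.univ i]
    simp only [Finset.mem_univ, if_true]
    ring
  rw [hsplit]
  simp only [phTrans, if_true]
  refine Finset.prod_le_prod (fun j _ => ?_) fun j _ => ?_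
  · split_ifs <;> positivity
  · split_ifs with hj
    · subst hj
      have h1 := h ε hε0 hε2
      rw [Function.update_self]
      nlinarith [mul_pos hc hε0]
    · have h1 := half_le_selProb_of_eq (κ := κ) (U := U) (C := C) (i := j) hε2
        (a0 := Function.update a i w) (a1 := Function.update a i x)
        (by rw [Function.update_of_ne hj, Function.update_of_ne hj])
      rw [Function.update_of_ne hj] at h1 ⊢
      linarith

lemma exists_minorized_of_reachIn (hA1 : Assumption1 C) (hκ0 : 0 < κ) (hκ2 : κ ≤ 1 / 2)
    (a : ∀ i, A i) {i : ι} {d : ℕ} {y : A i} (h : ReachIn C i d (a i) y) :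
    ∃ L w, (y ∈ C i w ∨ w = y) ∧
      Minorized κ U C L d (a, a) (Function.update a i w, Function.update a i y) := by
  induction d generalizing y with
  | zero =>
    have h : a i = y := h
    subst h
    exact ⟨0, a i, .inr rfl, by simpa using .refl (a, a)⟩
  | succ d ih =>
    rcases h with h | ⟨x, h, hy⟩
    · obtain ⟨L, w, hw, hL⟩ := ih h
      exact ⟨L, w, hw, hL.mono (Nat.le_succ d)⟩
    · obtain ⟨L, w, hw, hL⟩ := ih h
      by_cases hyx : y = x
      · subst hyx
        exact ⟨L, w, hw, hL.mono (Nat.le_succ d)⟩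
      · refine ⟨L + 1, x, .inl hy, hL.trans hA1.2.2 hκ0 hκ2 (minorized_of_single
          (c := 1 / (4 * (C i x).card)) ?_ fun ε hε0 hε2 => ?_)⟩
        · have : 0 < (C i x).card := Finset.card_pos.2 ⟨y, hy⟩
          positivity
        · have := le_selProb_explore (κ := κ) (U := U) (C := C) hκ0 hκ2 hε0 hε2
            (a0 := Function.update a i w) (a1 := Function.update a i x) (i := i) (x := y)
            (by rwa [Function.update_self]) (by rwa [Function.update_self])
          rwa [Function.update_self] at this

lemma exists_minorized_update (hA1 : Assumption1 C) (hA3 : Assumption3 U C) (hκ0 : 0 < κ)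
    (hκ2 : κ ≤ 1 / 2) (a : ∀ i, A i) {i : ι} {d : ℕ} {y : A i} (h : ReachIn C i d (a i) y) :
    ∃ L, Minorized κ U C L (d + 1) (a, a) (Function.update a i y, Function.update a i y) := by
  obtain ⟨L, w, hw, hL⟩ := exists_minorized_of_reachIn (U := U) hA1 hκ0 hκ2 a h
  refine ⟨L + 1, hL.trans hA1.2.2 hκ0 hκ2 (minorized_of_single (half_pos hκ0)
    fun ε hε0 hε2 => ?_)⟩
  have hd : U i (Function.update a i w) - U i (Function.update a i y) ≤ 1 := by
    rcases hw with hw | rfl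
    · have := hA3 i (Function.update a i y) w
        (by rw [Function.update_self]; exact (hA1.1 i w y).1 hw)
      rw [Function.update_idem] at this
      linarith
    · simp
  have := le_selProb_stay (C := C) hκ0 hκ2 hε0 hε2 hd
  rwa [Function.update_self] at this

lemma exists_minorized_diag_diag (hA1 : Assumption1 C) (hA3 : Assumption3 U C) (hκ0 : 0 < κ)
    (hκ2 : κ ≤ 1 / 2) {D : ℕ} (hD : ∀ (i : ι) (x y : A i), ReachIn C i D x y)
    (a b : ∀ i, A i) :
    ∃ L, Minorized κ U C L (Fintype.card ι * (D + 1)) (a, a) (b, b) := by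
  have key : ∀ s : Finset ι, ∃ L, Minorized κ U C L (s.card * (D + 1)) (a, a)
      (s.piecewise b a, s.piecewise b a) := by
    intro s
    induction s using Finset.induction_on with
    | empty => exact ⟨0, by simpa using .refl (a, a)⟩
    | insert j s hj ih =>
      obtain ⟨L, hL⟩ := ih
      obtain ⟨L', hL'⟩ := exists_minorized_update (U := U) hA1 hA3 hκ0 hκ2 (s.piecewise b a)
        (hD j _ (b j))
      refine ⟨L + L', ?_⟩
      rw [Finset.piecewise_insert, Finset.card_insert_of_notMem hj, Nat.succ_mul]
      exact hL.trans hA1.2.2 hκ0 hκ2 hL'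
  simpa using key Finset.univ

/-- A uniform Doeblin condition for the PHPIP transition matrices. -/
lemma exists_uniform_minorization (hA1 : Assumption1 C) (hA3 : Assumption3 U C) (hκ0 : 0 < κ)
    (hκ2 : κ ≤ 1 / 2) {D : ℕ} (hD : ∀ (i : ι) (x y : A i), ReachIn C i D x y)
    (b : ∀ i, A i) :
    ∃ L : ℕ, ∃ c : ℝ, 0 < c ∧ ∀ (εs : ℕ → ℝ) (k : ℕ) (e : ℝ), (∀ j, 0 ≤ εs j ∧ εs j ≤ 1) →
      0 < e → e ≤ 1 → (∀ j < L, e ≤ εs (k + j) ∧ εs (k + j) ≤ 1 / 2) →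
      ∀ z, c * e ^ (Fintype.card ι * (D + 1)) ≤
        chainProd (fun j => Matrix.of (phTrans κ U C (εs j))) k L z (b, b) := by
  have hz : ∀ z, ∃ L, Minorized κ U C L (Fintype.card ι * (D + 1)) z (b, b) := by
    intro z
    obtain ⟨L, a, h⟩ := exists_minorized_to_diag (U := U) hA1.2.2 hκ0 hκ2 z
    obtain ⟨L', h'⟩ := exists_minorized_diag_diag (U := U) hA1 hA3 hκ0 hκ2 hD a b
    exact ⟨L + L', by simpa using h.trans hA1.2.2 hκ0 hκ2 h'⟩
  choose L hL using hz
  have hpad : ∀ z, Minorized κ U C (Finset.univ.sup L) (Fintype.card ι * (D + 1)) z (b, b) := by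
    intro z
    have h := (hL z).trans hA1.2.2 hκ0 hκ2
      (minorized_diag hA1.2.2 hκ0 hκ2 b (Finset.univ.sup L - L z))
    rwa [Nat.add_sub_cancel' (Finset.le_sup (Finset.mem_univ z)), add_zero] at h
  choose c hc h using hpad
  obtain ⟨z₀, -, hz₀⟩ := Finset.exists_min_image Finset.univ c ⟨(b, b), Finset.mem_univ _⟩
  refine ⟨Finset.univ.sup L, c z₀, hc z₀, fun εs k e h01 he he1 hεs z => ?_⟩
  refine le_trans ?_ (h z εs k e h01 he he1 hεs)
  exact mul_le_mul_of_nonneg_right (hz₀ z (Finset.mem_univ z)) (by positivity)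

end Minorization

section TransitionCurve

variable {ι : Type*} {A : ι → Type*} {κ : ℝ} {U : ι → (∀ i, A i) → ℝ}
  {C : ∀ i, A i → Finset (A i)}

lemma exp_neg_rpow (t d : ℝ) : Real.exp (-t) ^ d = Real.exp (-d * t) := by
  rw [← Real.exp_mul]
  ring_nf

lemma exp_neg_mem_expPoly : (fun t : ℝ => Real.exp (-t)) ∈ expPoly := by
  simpa using exp_mem_expPoly (-1)

lemma ite_mem_expPoly (p : Prop) [Decidable p] {f g : ℝ → ℝ} (hf : f ∈ expPoly)
    (hg : g ∈ expPoly) : (fun t => if p then f t else g t) ∈ expPoly := by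
  split_ifs <;> assumption

lemma selProb_mem_expPoly (a0 a1 : ∀ i, A i) (i : ι) (x : A i) :
    (fun t => selProb κ U C (Real.exp (-t)) a0 a1 i x) ∈ expPoly := by
  have h0 := const_mem_expPoly 0
  have h1 : (fun t : ℝ => 1 - Real.exp (-t)) ∈ expPoly :=
    sub_mem (const_mem_expPoly 1) exp_neg_mem_expPoly
  have h2 : ∀ d, (fun t : ℝ => κ * Real.exp (-d * t)) ∈ expPoly := fun d =>
    mul_mem (const_mem_expPoly κ) (exp_mem_expPoly (-d))
  have h3 : ∀ s : Finset (A i), (fun t : ℝ => Real.exp (-t) / s.card) ∈ expPoly := fun s => by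
    simp only [div_eq_mul_inv]
    exact mul_mem exp_neg_mem_expPoly (const_mem_expPoly _)
  unfold selProb
  simp only [exp_neg_rpow]
  refine ite_mem_expPoly _ (add_mem (ite_mem_expPoly _ h1 h0) (ite_mem_expPoly _ (h3 _) h0))
    (add_mem (add_mem (ite_mem_expPoly _ (mul_mem h1 (h2 _)) h0)
      (ite_mem_expPoly _ (mul_mem h1 (sub_mem (const_mem_expPoly 1) (h2 _))) h0))
      (ite_mem_expPoly _ (h3 _) h0))

variable [Fintype ι]

lemma phTrans_mem_expPoly (z w : (∀ i, A i) × (∀ i, A i)) :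
    (fun t => phTrans κ U C (Real.exp (-t)) z w) ∈ expPoly := by
  refine ite_mem_expPoly _ ?_ (const_mem_expPoly 0)
  have : (fun t => ∏ i, selProb κ U C (Real.exp (-t)) z.1 z.2 i (w.2 i)) =
      ∏ i, fun t => selProb κ U C (Real.exp (-t)) z.1 z.2 i (w.2 i) := by
    ext t
    simp [Finset.prod_apply]
  rw [this]
  exact prod_mem fun i _ => selProb_mem_expPoly _ _ _ _

end TransitionCurve

section Rate

lemma pipipRate_mem_Icc (n D k : ℕ) : 0 ≤ pipipRate n D k ∧ pipipRate n D k ≤ 1 := by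
  refine ⟨Real.rpow_nonneg (Nat.cast_nonneg k) _, ?_⟩
  have hexp : -(1 : ℝ) / ((n : ℝ) * ((D : ℝ) + 1)) ≤ 0 :=
    div_nonpos_of_nonpos_of_nonneg (by norm_num) (by positivity)
  rcases Nat.eq_zero_or_pos k with rfl | hk
  · rw [pipipRate, Nat.cast_zero]
    exact Real.zero_rpow_le_one _
  · exact Real.rpow_le_one_of_one_le_of_nonpos (by exact_mod_cast hk) hexp

lemma pipipRate_eq_exp (n D : ℕ) {k : ℕ} (hk : 1 ≤ k) :
    pipipRate n D k = Real.exp (-(Real.log k / (n * (D + 1)))) := by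
  rw [pipipRate, Real.rpow_def_of_pos (by exact_mod_cast hk)]
  ring_nf

lemma pipipRate_anti (n D : ℕ) {k k' : ℕ} (hk : 1 ≤ k) (h : k ≤ k') :
    pipipRate n D k' ≤ pipipRate n D k := by
  have h1 : (0 : ℝ) < k := by exact_mod_cast hk
  have h2 : (k : ℝ) ≤ k' := by exact_mod_cast h
  rw [pipipRate_eq_exp n D hk, pipipRate_eq_exp n D (hk.trans h)]
  gcongr

lemma pipipRate_pow {n : ℕ} (hn : n ≠ 0) (D k : ℕ) :
    pipipRate n D k ^ (n * (D + 1)) = 1 / (k : ℝ) := by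
  have hn' : (n : ℝ) ≠ 0 := by exact_mod_cast hn
  have hD : (D : ℝ) + 1 ≠ 0 := by positivity
  have hmul : -(1 : ℝ) / ((n : ℝ) * ((D : ℝ) + 1)) * ((n * (D + 1) : ℕ) : ℝ) = -1 := by
    push_cast
    field_simp
  rw [pipipRate, ← Real.rpow_natCast, ← Real.rpow_mul (Nat.cast_nonneg k), hmul,
    Real.rpow_neg_one, one_div]

end Rate

section Theorems

variable {ι : Type*} [Fintype ι] [DecidableEq ι] {A : ι → Type*} [∀ i, Fintype (A i)]

theorem statement17
    (U : ι → (∀ i, A i) → ℝ) (C : ∀ i, A i → Finset (A i))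
    (hA1 : Assumption1 C) (hA3 : Assumption3 U C)
    (D : ℕ) (hD1 : ∀ (i : ι) (x y : A i), ReachIn C i D x y)
    (hD2 : ∀ d : ℕ, d < D → ¬ ∀ (i : ι) (x y : A i), ReachIn C i d x y)
    (Cmax : ℕ)
    (hCmax : Cmax = Finset.univ.sup fun i : ι => Finset.univ.sup fun a : A i => (C i a).card)
    (κ : ℝ) (hκ1 : 1 / ((Cmax : ℝ) - 1) < κ) (hκ2 : κ ≤ 1 / 2)
    (μ : ℝ → ((∀ i, A i) × (∀ i, A i)) → ℝ)
    (hμ : ∀ ε : ℝ, 0 < ε → ε ≤ 1 / 2 →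
      (∀ z, 0 ≤ μ ε z) ∧ (∑ z : (∀ i, A i) × (∀ i, A i), μ ε z = 1) ∧
      (∀ z', ∑ z : (∀ i, A i) × (∀ i, A i), μ ε z * phTrans κ U C ε z z' = μ ε z') ∧
      (∀ ν : ((∀ i, A i) × (∀ i, A i)) → ℝ, (∀ z, 0 ≤ ν z) →
        (∑ z : (∀ i, A i) × (∀ i, A i), ν z = 1) →
        (∀ z', ∑ z : (∀ i, A i) × (∀ i, A i), ν z * phTrans κ U C ε z z' = ν z') → ν = μ ε)) :
    ∃ μstar : ((∀ i, A i) × (∀ i, A i)) → ℝ,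
      (∀ z, 0 ≤ μstar z) ∧ (∑ z : (∀ i, A i) × (∀ i, A i), μstar z = 1) ∧
      (∀ ν : ((∀ i, A i) × (∀ i, A i)) → ℝ, (∀ z, 0 ≤ ν z) →
        (∑ z : (∀ i, A i) × (∀ i, A i), ν z = 1) →
        ∀ k0 : ℕ, ∀ z : (∀ i, A i) × (∀ i, A i),
          Tendsto (fun k : ℕ => ∑ z0 : (∀ i, A i) × (∀ i, A i),
              ν z0 * transProd κ U C (pipipRate (Fintype.card ι) D) k0 (k - k0) z0 z)
            atTop (𝓝 (μstar z))) ∧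
      (∀ z, Tendsto (fun ε : ℝ => μ ε z) (𝓝[>] (0 : ℝ)) (𝓝 (μstar z))) := by
  have hmain : ∀ ε : ℝ, 0 < ε → ε ≤ 1 / 2 → (∑ z, μ ε z = 1) ∧
      Matrix.vecMul (μ ε) (Matrix.of (phTrans κ U C ε)) = μ ε := fun ε h0 h2 =>
    ⟨(hμ ε h0 h2).2.1, funext (hμ ε h0 h2).2.2.1⟩
  have hne : Nonempty (∀ i, A i) := by
    by_contra h
    rw [not_nonempty_iff] at h
    have := (hmain (1 / 2) (by norm_num) le_rfl).1
    simp at this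
  obtain ⟨b⟩ := hne
  rcases isEmpty_or_nonempty ι with hι | ⟨⟨i₀⟩⟩
  · have huniq : ∀ z z' : (∀ i, A i) × (∀ i, A i), z = z' := fun z z' => Subsingleton.elim _ _
    have hsum : ∀ (f : (∀ i, A i) × (∀ i, A i) → ℝ) z, ∑ w, f w = f z := fun f z =>
      Fintype.sum_eq_single z fun w hw => absurd (huniq w z) hw
    have htr : ∀ (εs : ℕ → ℝ) k m z z', transProd κ U C εs k m z z' = 1 := by
      intro εs k m z z'
      induction m generalizing z' with
      | zero => simp [transProd, huniq z z']
      | succ m ih =>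
        rw [transProd, hsum _ z', ih]
        simp [phTrans, Subsingleton.elim z'.1 z'.2]
    refine ⟨fun _ => 1, fun _ => zero_le_one, hsum _ (b, b), fun ν _ hν k0 z => ?_, fun z => ?_⟩
    · simp only [htr, mul_one, hν]
      exact tendsto_const_nhds
    · refine tendsto_const_nhds.congr' ?_
      filter_upwards [Ioc_mem_nhdsGT (show (0 : ℝ) < 1 / 2 by norm_num)] with ε hε
      rw [← (hmain ε hε.1 hε.2).1, hsum _ z]
  have hn : Fintype.card ι ≠ 0 := Finset.card_ne_zero_of_mem (Finset.mem_univ i₀)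
  have hCm : (3 : ℝ) ≤ Cmax := by
    have h1 := hA1.2.2 i₀ (b i₀)
    have h2 : (C i₀ (b i₀)).card ≤ Cmax := by
      rw [hCmax]
      exact (Finset.le_sup (f := fun a : A i₀ => (C i₀ a).card) (Finset.mem_univ (b i₀))).trans
        (Finset.le_sup (f := fun i : ι => Finset.univ.sup fun a : A i => (C i a).card)
          (Finset.mem_univ i₀))
    exact_mod_cast h1.trans h2
  have hκ0 : 0 < κ := lt_trans (one_div_pos.2 (by linarith)) hκ1
  obtain ⟨L, c, hc, hmin⟩ := exists_uniform_minorization (U := U) hA1 hA3 hκ0 hκ2 hD1 b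
  have hexp : ∀ t : ℝ, Real.log 2 ≤ t → Real.exp (-t) ≤ 1 / 2 := by
    intro t ht
    rw [Real.exp_neg, one_div]
    refine inv_anti₀ two_pos ?_
    rw [← Real.exp_log (two_pos (α := ℝ))]
    exact Real.exp_le_exp.2 ht
  have hexp1 : ∀ t : ℝ, Real.log 2 ≤ t → Real.exp (-t) ≤ 1 := fun t ht =>
    (hexp t ht).trans (by norm_num)
  have hmono := eventually_monotone_stationary (v := fun t => μ (Real.exp (-t)))
    (P := fun t => Matrix.of (phTrans κ U C (Real.exp (-t)))) (L := L) (z₀ := (b, b))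
    phTrans_mem_expPoly
    (fun t ht => isStochastic_phTrans hA1.2.2 hκ0 hκ2 (Real.exp_pos _).le (hexp1 t ht))
    (fun t ht => ⟨_, mul_pos hc (pow_pos (Real.exp_pos (-t)) _),
      hmin (fun _ => Real.exp (-t)) 0 _ (fun _ => ⟨(Real.exp_pos _).le, hexp1 t ht⟩)
        (Real.exp_pos _) (hexp1 t ht) fun _ _ => ⟨le_rfl, hexp t ht⟩⟩)
    (fun t ht => (hmain _ (Real.exp_pos _) (hexp t ht)).1)
    (fun t ht => (hmain _ (Real.exp_pos _) (hexp t ht)).2)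
  have hμ0 : ∀ t : ℝ, Real.log 2 ≤ t → ∀ z, 0 ≤ μ (Real.exp (-t)) z := fun t ht =>
    (hμ _ (Real.exp_pos _) (hexp t ht)).1
  have hμ1 : ∀ t : ℝ, Real.log 2 ≤ t → ∀ z, μ (Real.exp (-t)) z ≤ 1 := fun t ht z => by
    rw [← (hmain _ (Real.exp_pos _) (hexp t ht)).1]
    exact Finset.single_le_sum (fun w _ => hμ0 t ht w) (Finset.mem_univ z)
  have hlim : ∀ z, ∃ l, Tendsto (fun t => μ (Real.exp (-t)) z) atTop (𝓝 l) := by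
    intro z
    obtain ⟨T, hT | hT⟩ := hmono z
    · exact MonotoneOn.exists_tendsto_of_bounded (d := 1)
        (hT.mono (Ici_subset_Ici.2 (le_max_left T (Real.log 2))))
        fun t ht => hμ1 t ((le_max_right _ _).trans ht) z
    · obtain ⟨l, hl⟩ := MonotoneOn.exists_tendsto_of_bounded (d := 0)
        (hT.neg.mono (Ici_subset_Ici.2 (le_max_left T (Real.log 2))))
        fun t ht => neg_nonpos.2 (hμ0 t ((le_max_right _ _).trans ht) z)
      exact ⟨-l, by simpa using hl.neg⟩
  choose μstar hμstar using hlim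
  have hlog := eventually_ge_atTop (Real.log 2)
  refine ⟨μstar, fun z => ge_of_tendsto (hμstar z) (hlog.mono fun t ht => hμ0 t ht z), ?_,
    fun ν _ hν k0 z => ?_, fun z => ?_⟩
  · refine tendsto_nhds_unique (tendsto_finsetSum _ fun z _ => hμstar z)
      (tendsto_const_nhds.congr' (hlog.mono fun t ht => ?_))
    exact (hmain _ (Real.exp_pos _) (hexp t ht)).1.symm
  · have hnD : (0 : ℝ) < Fintype.card ι * ((D : ℝ) + 1) := by
      have : (0 : ℝ) < Fintype.card ι := by exact_mod_cast Nat.pos_of_ne_zero hn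
      positivity
    set τ : ℕ → ℝ := fun k => Real.log k / (Fintype.card ι * (D + 1)) with hτ
    have hτm : MonotoneOn τ (Ici 1) := by
      intro k hk k' _ h
      have h1 : (0 : ℝ) < k := by exact_mod_cast (mem_Ici.1 hk)
      have h2 : (k : ℝ) ≤ k' := by exact_mod_cast h
      simp only [hτ]
      gcongr
    have hτt : Tendsto τ atTop atTop :=
      (Real.tendsto_log_atTop.comp tendsto_natCast_atTop_atTop).atTop_div_const hnD
    obtain ⟨K, hK⟩ := eventually_atTop.1 (hτt.eventually_ge_atTop (Real.log 2))
    have hrate : ∀ k, 1 ≤ k → pipipRate (Fintype.card ι) D k = Real.exp (-τ k) := fun k hk =>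
      pipipRate_eq_exp _ _ hk
    have hρ : ∀ k, max K 1 ≤ k → pipipRate (Fintype.card ι) D k = Real.exp (-τ k) ∧
        Real.exp (-τ k) ≤ 1 / 2 := fun k hk =>
      ⟨hrate k (by omega), hexp _ (hK k (by omega))⟩
    simp only [transProd_eq_chainProd]
    refine strongly_ergodic_of_doeblin
      (P := fun k => Matrix.of (phTrans κ U C (pipipRate (Fintype.card ι) D k)))
      (ρ := fun k => μ (Real.exp (-τ k))) (K := max K 1) (L := L) (z₀ := (b, b))
      (δ := fun k => c * (1 / ((k + L : ℕ) : ℝ)))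
      (fun k => isStochastic_phTrans hA1.2.2 hκ0 hκ2 (pipipRate_mem_Icc _ _ _).1
        (pipipRate_mem_Icc _ _ _).2)
      (fun k hk => (hmain _ (Real.exp_pos _) (hρ k hk).2).1)
      (fun k hk => ?_) (fun z => ?_) (fun z => (hμstar z).comp hτt) (fun k => by positivity)
      ?_ (fun k hk z => ?_) hν k0 z
    · rw [(hρ k hk).1]
      exact (hmain _ (Real.exp_pos _) (hρ k hk).2).2
    · obtain ⟨T, hT⟩ := hmono z
      exact summable_abs_sub_of_eventually_monotone hT (hμstar z) hτm hτt
    · rw [summable_mul_left_iff hc.ne', summable_nat_add_iff (f := fun k : ℕ => 1 / (k : ℝ)) L]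
      exact Real.not_summable_one_div_natCast
    · rw [← pipipRate_pow hn D (k + L)]
      refine hmin _ k _ (pipipRate_mem_Icc _ _) ?_ (pipipRate_mem_Icc _ _ _).2 (fun j hj => ?_) z
      · rw [hrate _ (by omega)]
        exact Real.exp_pos _
      · refine ⟨pipipRate_anti _ _ (by omega) (by omega), ?_⟩
        rw [(hρ (k + j) (by omega)).1]
        exact (hρ (k + j) (by omega)).2
  · have h := (hμstar z).comp (tendsto_neg_atBot_atTop.comp Real.tendsto_log_nhdsGT_zero)
    refine h.congr' ?_
    filter_upwards [self_mem_nhdsWithin] with ε hε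
    simp only [Function.comp_apply, neg_neg]
    rw [Real.exp_log hε]

end Theorems
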